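/- arXiv:2004.01450 — 3 statements merged into one kernel-verified Lean document; each statement's English description precedes it below -/
import Mathlib

section
/- Let Λ be the set of ten edges (2-element subsets) of {1,2,3,4,5}, and for λ ∈ Λ let r_λ : V^5 → ℝ be the characteristic linear functionals. Under the action of S_5 on linear functionals induced by η_5, given by (π·f)(x) = f(η_5(π)^{-1} x), the set ℛ = {± r_λ : λ ∈ Λ} is preserved by S_5, with π · r_λ = ± r_{π(λ)} for every π ∈ S_5 and λ ∈ Λ, and S_5 acts transitively on ℛ. -/
open Equiv

/-- XOR on `Fin 4` (the Klein group structure on vertices of a tetrahedron). -/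
def xor4 (a b : Fin 4) : Fin 4 :=
  ⟨(a.val ^^^ b.val) % 4, Nat.mod_lt _ (by norm_num)⟩

/-- The underlying function of the cross-ratio homomorphism `φ : S₄ → S₃`:
a permutation of the vertices `{0,1,2,3}` of a tetrahedron induces a permutation of the
three partitions of the vertex set into two pairs of opposite edges; the partition pairing
`0` with `j+1` is indexed by `j : Fin 3`. -/
def phiFun (π : Perm (Fin 4)) (j : Fin 3) : Fin 3 :=
  ⟨(xor4 (π 0) (π ⟨j.val + 1, by omega⟩)).val - 1, by
    have h := (xor4 (π 0) (π ⟨j.val + 1, by omega⟩)).isLt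
    omega⟩

lemma phiFun_leftInv : ∀ (π : Perm (Fin 4)) (j : Fin 3), phiFun π⁻¹ (phiFun π j) = j := by
  decide

/-- The cross-ratio homomorphism `φ : S₄ → S₃`. -/
def phi (π : Perm (Fin 4)) : Perm (Fin 3) where
  toFun := phiFun π
  invFun := phiFun π⁻¹
  left_inv := phiFun_leftInv π
  right_inv := fun j => by simpa using phiFun_leftInv π⁻¹ j

/-- Restriction of a permutation `π` to a bijection between the complement of `{i}`
and the complement of `{π i}`. -/
def restrictPerm {k : ℕ} (π : Perm (Fin k)) (i : Fin k) :
    {x : Fin k // x ≠ i} ≃ {x : Fin k // x ≠ π i} where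
  toFun x := ⟨π x.1, fun h => x.2 (π.injective h)⟩
  invFun y := ⟨π.symm y.1, fun h => y.2 (by simpa using congrArg π h)⟩
  left_inv x := Subtype.ext (π.symm_apply_apply x.1)
  right_inv y := Subtype.ext (π.apply_symm_apply y.1)

/-- The induced permutation `π_i ∈ S_k` of `π ∈ S_{k+1}`: the restriction of `π` to the
complement of `{i}`, reindexed via the order preserving identifications with `Fin k`. -/
def inducedPerm {k : ℕ} (π : Perm (Fin (k + 1))) (i : Fin (k + 1)) : Perm (Fin k) :=
  ((finSuccAboveEquiv i).trans ((restrictPerm π i).trans (finSuccAboveEquiv (π i)).symm))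

/-- `η₄ : S₄ → Aut(V⁴)`, `V⁴ = ℝ³`: the signed cross-ratio representation,
`η₄(π)(e_j) = sign(π) e_{φ(π) j}`. -/
noncomputable def eta4fun (π : Equiv.Perm (Fin 4)) (v : Fin 3 → ℝ) : Fin 3 → ℝ :=
  fun j => ((Equiv.Perm.sign π : ℤ) : ℝ) * v ((phi π)⁻¹ j)

/-- The canonical representation `η₅ : S₅ → Aut(V⁵)` on the space `V⁵` of `5 × 3`
real matrices: `η₅(π)(e_i ⊗ u) = e_{π(i)} ⊗ η₄(π_i)(u)`. -/
noncomputable def eta5fun (π : Equiv.Perm (Fin 5)) (v : Fin 5 → Fin 3 → ℝ) :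
    Fin 5 → Fin 3 → ℝ :=
  fun i => eta4fun (inducedPerm π (π⁻¹ i)) (v (π⁻¹ i))

/-- `η₅(π)` as a linear endomorphism of `V⁵`. -/
noncomputable def eta5lin (π : Equiv.Perm (Fin 5)) :
    (Fin 5 → Fin 3 → ℝ) →ₗ[ℝ] (Fin 5 → Fin 3 → ℝ) where
  toFun := eta5fun π
  map_add' := by
    intro v w; funext i j; simp [eta5fun, eta4fun, mul_add]
  map_smul' := by
    intro c v; funext i j; simp [eta5fun, eta4fun, smul_eq_mul]; ring

/-- Coefficient matrices of the ten characteristic functionals `r_λ`, `λ` an edge of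
`{1,…,5}` (0-indexed: rows `1,…,5` become `0,…,4`, columns `(a,b,c)` become `(0,1,2)`).
`rc p q` is the coefficient matrix of `r_{(p+1)(q+1)}` for `p < q`, and `0` otherwise. -/
def rc : Fin 5 → Fin 5 → Fin 5 → Fin 3 → ℝ :=
  -- r₁₂ = −a₃+a₄−a₅, r₁₃ = −a₂−b₄+b₅, r₁₄ = b₂−b₃−c₅, r₁₅ = −c₂+c₃−c₄,
  -- r₂₃ = −a₁+c₄−c₅, r₂₄ = b₁+c₃+b₅, r₂₅ = −c₁−b₃+b₄,
  -- r₃₄ = −c₁+c₂−a₅, r₃₅ = b₁−b₂−a₄, r₄₅ = −a₁+a₂−a₃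
  ![![0,
     ![![0,0,0], ![0,0,0], ![-1,0,0], ![1,0,0], ![-1,0,0]],
     ![![0,0,0], ![-1,0,0], ![0,0,0], ![0,-1,0], ![0,1,0]],
     ![![0,0,0], ![0,1,0], ![0,-1,0], ![0,0,0], ![0,0,-1]],
     ![![0,0,0], ![0,0,-1], ![0,0,1], ![0,0,-1], ![0,0,0]]],
    ![0, 0,
     ![![-1,0,0], ![0,0,0], ![0,0,0], ![0,0,1], ![0,0,-1]],
     ![![0,1,0], ![0,0,0], ![0,0,1], ![0,0,0], ![0,1,0]],
     ![![0,0,-1], ![0,0,0], ![0,-1,0], ![0,1,0], ![0,0,0]]],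
    ![0, 0, 0,
     ![![0,0,-1], ![0,0,1], ![0,0,0], ![0,0,0], ![-1,0,0]],
     ![![0,1,0], ![0,-1,0], ![0,0,0], ![-1,0,0], ![0,0,0]]],
    ![0, 0, 0, 0,
     ![![-1,0,0], ![1,0,0], ![-1,0,0], ![0,0,0], ![0,0,0]]],
    ![0, 0, 0, 0, 0]]

/-- The characteristic functional `r_λ : V⁵ → ℝ` for the edge `λ = {p,q}`, `p < q`. -/
def rfun (p q : Fin 5) (v : Fin 5 → Fin 3 → ℝ) : ℝ :=
  ∑ i, ∑ j, rc p q i j * v i j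

/-- The chosen representative `r_λ` of the edge `λ = {p,q}` (edges are unordered). -/
def sortedR (p q : Fin 5) : (Fin 5 → Fin 3 → ℝ) → ℝ :=
  if p < q then rfun p q else rfun q p

/-- The action of `S₅` on functions `f : V⁵ → ℝ` induced by `η₅`:
`(π·f)(x) = f(η₅(π)⁻¹ x)`. -/
noncomputable def permAct (π : Equiv.Perm (Fin 5)) (f : (Fin 5 → Fin 3 → ℝ) → ℝ) :
    (Fin 5 → Fin 3 → ℝ) → ℝ :=
  fun v => f (eta5fun π⁻¹ v)

/-- The set `ℛ = {± r_λ : λ ∈ Λ}` of signed characteristic functionals. -/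
def Rset : Set ((Fin 5 → Fin 3 → ℝ) → ℝ) :=
  {f | ∃ p q : Fin 5, p < q ∧ (f = rfun p q ∨ f = fun v => -(rfun p q v))}

/-- Integer version of the coefficient table `rc`. -/
def rcZ : Fin 5 → Fin 5 → Fin 5 → Fin 3 → ℤ :=
  ![![0,
     ![![0,0,0], ![0,0,0], ![-1,0,0], ![1,0,0], ![-1,0,0]],
     ![![0,0,0], ![-1,0,0], ![0,0,0], ![0,-1,0], ![0,1,0]],
     ![![0,0,0], ![0,1,0], ![0,-1,0], ![0,0,0], ![0,0,-1]],
     ![![0,0,0], ![0,0,-1], ![0,0,1], ![0,0,-1], ![0,0,0]]],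
    ![0, 0,
     ![![-1,0,0], ![0,0,0], ![0,0,0], ![0,0,1], ![0,0,-1]],
     ![![0,1,0], ![0,0,0], ![0,0,1], ![0,0,0], ![0,1,0]],
     ![![0,0,-1], ![0,0,0], ![0,-1,0], ![0,1,0], ![0,0,0]]],
    ![0, 0, 0,
     ![![0,0,-1], ![0,0,1], ![0,0,0], ![0,0,0], ![-1,0,0]],
     ![![0,1,0], ![0,-1,0], ![0,0,0], ![-1,0,0], ![0,0,0]]],
    ![0, 0, 0, 0,
     ![![-1,0,0], ![1,0,0], ![-1,0,0], ![0,0,0], ![0,0,0]]],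
    ![0, 0, 0, 0, 0]]

lemma rc_eq_rcZ (p q : Fin 5) (i : Fin 5) (j : Fin 3) : rc p q i j = ((rcZ p q i j : ℤ) : ℝ) := by
  fin_cases p <;> fin_cases q <;> fin_cases i <;> fin_cases j <;> simp [rc, rcZ]

/-- A cheap formula for the sign of a permutation of four points. -/
def sgn4 (π : Perm (Fin 4)) : ℤ :=
  (if π 0 < π 1 then 1 else -1) * (if π 0 < π 2 then 1 else -1) *
  (if π 0 < π 3 then 1 else -1) * (if π 1 < π 2 then 1 else -1) *
  (if π 1 < π 3 then 1 else -1) * (if π 2 < π 3 then 1 else -1)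

lemma sgn4_eq : ∀ π : Perm (Fin 4), ((Equiv.Perm.sign π : ℤˣ) : ℤ) = sgn4 π := by
  decide +kernel

/-- Coefficients of the functional `v ↦ r_{pq} (η₅(σ) v)`. -/
def coefZ (σ : Perm (Fin 5)) (p q i : Fin 5) (j : Fin 3) : ℤ :=
  sgn4 (inducedPerm σ i) * rcZ p q (σ i) (phiFun (inducedPerm σ i) j)

lemma rfun_eta5 (σ : Perm (Fin 5)) (p q : Fin 5) (v : Fin 5 → Fin 3 → ℝ) :
    rfun p q (eta5fun σ v) = ∑ i, ∑ j, ((coefZ σ p q i j : ℤ) : ℝ) * v i j := by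
  unfold rfun
  rw [← Equiv.sum_comp σ]
  refine Finset.sum_congr rfl fun i _ => ?_
  rw [← Equiv.sum_comp (phi (inducedPerm σ i))]
  refine Finset.sum_congr rfl fun j _ => ?_
  have e5 : σ⁻¹ (σ i) = i := σ.symm_apply_apply i
  have e3 : (phi (inducedPerm σ i))⁻¹ (phi (inducedPerm σ i) j) = j :=
    (phi (inducedPerm σ i)).symm_apply_apply j
  have h : phi (inducedPerm σ i) j = phiFun (inducedPerm σ i) j := rfl
  simp only [eta5fun, eta4fun, e5, e3, sgn4_eq, rc_eq_rcZ, coefZ, ← h]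
  push_cast
  ring

lemma coef_key : ∀ (x y : Fin 5), x ≠ y → ∀ (p q : Fin 5), p < q →
    (∀ i j, coefZ (swap x y) p q i j =
      if swap x y p < swap x y q then rcZ (swap x y p) (swap x y q) i j
      else rcZ (swap x y q) (swap x y p) i j) ∨
    (∀ i j, coefZ (swap x y) p q i j =
      -(if swap x y p < swap x y q then rcZ (swap x y p) (swap x y q) i j
      else rcZ (swap x y q) (swap x y p) i j)) := by
  decide +kernel

lemma coef_flip : ∃ x y : Fin 5, ∀ i j, coefZ (swap x y)⁻¹ 0 1 i j = -rcZ 0 1 i j := by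
  decide +kernel

lemma two_transitive : ∀ p q : Fin 5, p < q →
    (swap (swap 0 p 1) q * swap 0 p) 0 = p ∧ (swap (swap 0 p 1) q * swap 0 p) 1 = q := by
  decide +kernel

lemma phi_mul : ∀ (π ρ : Perm (Fin 4)) (j : Fin 3),
    phiFun (π * ρ) j = phiFun π (phiFun ρ j) := by
  decide +kernel

lemma phi_mul' (π ρ : Perm (Fin 4)) : phi (π * ρ) = phi π * phi ρ :=
  Equiv.ext (phi_mul π ρ)

lemma inducedPerm_mul (σ τ : Perm (Fin 5)) (i : Fin 5) :
    inducedPerm (σ * τ) i = inducedPerm σ (τ i) * inducedPerm τ i := by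
  apply Equiv.ext
  intro k
  have e := (finSuccAboveEquiv (τ i)).apply_symm_apply
    (restrictPerm τ i (finSuccAboveEquiv i k))
  exact (congrArg (fun z => (finSuccAboveEquiv (σ (τ i))).symm (restrictPerm σ (τ i) z)) e).symm

lemma eta4_mul (π ρ : Perm (Fin 4)) (v : Fin 3 → ℝ) :
    eta4fun (π * ρ) v = eta4fun π (eta4fun ρ v) := by
  funext j
  simp only [eta4fun, phi_mul', mul_inv_rev, Perm.mul_apply, Perm.sign_mul, Units.val_mul]
  push_cast
  ring

lemma eta5_mul (σ τ : Perm (Fin 5)) (v : Fin 5 → Fin 3 → ℝ) :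
    eta5fun (σ * τ) v = eta5fun σ (eta5fun τ v) := by
  funext i
  have e : τ (τ⁻¹ (σ⁻¹ i)) = σ⁻¹ i := τ.apply_symm_apply _
  simp only [eta5fun, mul_inv_rev, Perm.mul_apply, inducedPerm_mul, eta4_mul, e]

lemma permAct_mul (σ τ : Perm (Fin 5)) (f : (Fin 5 → Fin 3 → ℝ) → ℝ) :
    permAct (σ * τ) f = permAct σ (permAct τ f) := by
  funext v
  simp only [permAct, mul_inv_rev, eta5_mul]

lemma eta5_one (v : Fin 5 → Fin 3 → ℝ) : eta5fun 1 v = v := by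
  have h : ∀ i, inducedPerm (1 : Perm (Fin 5)) i = 1 := by
    intro i
    apply Equiv.ext
    intro k
    change (finSuccAboveEquiv i).symm (finSuccAboveEquiv i k) = k
    exact Equiv.symm_apply_apply _ _
  have h3 : phi 1 = 1 := Equiv.ext (by decide)
  funext i j
  simp [eta5fun, eta4fun, h, h3]

lemma permAct_one (f : (Fin 5 → Fin 3 → ℝ) → ℝ) : permAct 1 f = f := by
  funext v
  simp only [permAct, inv_one, eta5_one]

lemma permAct_pos {σ : Perm (Fin 5)} {p q p' q' : Fin 5}
    (h : ∀ i j, coefZ σ⁻¹ p q i j = rcZ p' q' i j) : permAct σ (rfun p q) = rfun p' q' := by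
  funext v
  simp only [permAct, rfun_eta5, h]
  simp only [rfun, rc_eq_rcZ]

lemma permAct_neg {σ : Perm (Fin 5)} {p q p' q' : Fin 5}
    (h : ∀ i j, coefZ σ⁻¹ p q i j = -rcZ p' q' i j) :
    permAct σ (rfun p q) = fun v => -(rfun p' q' v) := by
  funext v
  simp only [permAct, rfun_eta5, h]
  simp only [rfun, rc_eq_rcZ, Int.cast_neg, neg_mul, Finset.sum_neg_distrib]

lemma permAct_negf (σ : Perm (Fin 5)) (f : (Fin 5 → Fin 3 → ℝ) → ℝ) :
    permAct σ (fun v => -(f v)) = fun v => -(permAct σ f v) := rfl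

lemma sortedR_comm (p q : Fin 5) : sortedR p q = sortedR q p := by
  unfold sortedR
  rcases lt_trichotomy p q with h | h | h
  · simp [h, h.not_gt]
  · simp [h]
  · simp [h, h.not_gt]

lemma swap_case {x y : Fin 5} (hxy : x ≠ y) (p q : Fin 5) (hpq : p < q) :
    permAct (swap x y) (rfun p q) = sortedR (swap x y p) (swap x y q) ∨
    permAct (swap x y) (rfun p q) = fun v => -(sortedR (swap x y p) (swap x y q) v) := by
  have h := coef_key x y hxy p q hpq
  have key : ∀ i j, coefZ (swap x y) p q i j = coefZ (swap x y)⁻¹ p q i j := by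
    intro i j; rw [swap_inv]
  simp only [key] at h
  unfold sortedR
  rcases h with h | h
  · left
    split_ifs at h ⊢ with hlt
    · exact permAct_pos h
    · exact permAct_pos h
  · right
    split_ifs at h ⊢ with hlt
    · exact permAct_neg h
    · exact permAct_neg h

lemma sorted_case (σ : Perm (Fin 5)) : ∀ p q : Fin 5, p ≠ q →
    permAct σ (sortedR p q) = sortedR (σ p) (σ q) ∨
    permAct σ (sortedR p q) = fun v => -(sortedR (σ p) (σ q) v) := by
  induction σ using Equiv.Perm.swap_induction_on with
  | one => intro p q _; left; exact permAct_one _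
  | swap_mul τ x y hxy ih =>
    have hs : ∀ p q : Fin 5, p ≠ q →
        permAct (swap x y) (sortedR p q) = sortedR (swap x y p) (swap x y q) ∨
        permAct (swap x y) (sortedR p q) =
          fun v => -(sortedR (swap x y p) (swap x y q) v) := by
      intro p q hpq
      rcases lt_or_gt_of_ne hpq with h | h
      · have := swap_case hxy p q h
        rwa [show rfun p q = sortedR p q by simp [sortedR, h]] at this
      · have := swap_case hxy q p h
        rwa [show rfun q p = sortedR p q by simp [sortedR, h.not_gt],
          sortedR_comm (swap x y q)] at this
    intro p q hpq
    rw [permAct_mul]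
    simp only [Perm.mul_apply]
    have h2 := hs (τ p) (τ q) (τ.injective.ne hpq)
    rcases ih p q hpq with h | h <;> rw [h]
    · exact h2
    · rw [permAct_negf]
      rcases h2 with h2 | h2 <;> rw [h2]
      · exact Or.inr rfl
      · left; simp only [neg_neg]

lemma part_one (σ : Perm (Fin 5)) (p q : Fin 5) (hpq : p < q) :
    permAct σ (rfun p q) = sortedR (σ p) (σ q) ∨
    permAct σ (rfun p q) = fun v => -(sortedR (σ p) (σ q) v) := by
  have := sorted_case σ p q hpq.ne
  rwa [show sortedR p q = rfun p q by simp [sortedR, hpq]] at this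

lemma reach {f : (Fin 5 → Fin 3 → ℝ) → ℝ} (hf : f ∈ Rset) :
    ∃ σ : Perm (Fin 5), permAct σ (rfun 0 1) = f := by
  obtain ⟨p, q, hpq, hf⟩ := hf
  obtain ⟨h0, h1⟩ := two_transitive p q hpq
  obtain ⟨x, y, hxy⟩ := coef_flip
  have hflip := permAct_neg hxy
  have hσ := part_one (swap (swap 0 p 1) q * swap 0 p) 0 1 (by decide)
  generalize swap (swap 0 p 1) q * swap 0 p = σ at h0 h1 hσ
  rw [h0, h1, show sortedR p q = rfun p q by simp [sortedR, hpq]] at hσ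
  have hσ' : permAct (σ * swap x y) (rfun 0 1) = fun v => -(permAct σ (rfun 0 1) v) := by
    rw [permAct_mul, hflip, permAct_negf]
  rcases hσ with h | h <;> rcases hf with rfl | rfl
  · exact ⟨σ, h⟩
  · exact ⟨σ * swap x y, by rw [hσ', h]⟩
  · exact ⟨σ * swap x y, by rw [hσ', h]; simp only [neg_neg]⟩
  · exact ⟨σ, h⟩

lemma sortedR_mem {p q : Fin 5} (h : p ≠ q) :
    sortedR p q ∈ Rset ∧ (fun v => -(sortedR p q v)) ∈ Rset := by
  unfold sortedR
  split_ifs with hlt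
  · exact ⟨⟨p, q, hlt, Or.inl rfl⟩, ⟨p, q, hlt, Or.inr rfl⟩⟩
  · have hlt' : q < p := lt_of_le_of_ne (not_lt.mp hlt) h.symm
    exact ⟨⟨q, p, hlt', Or.inl rfl⟩, ⟨q, p, hlt', Or.inr rfl⟩⟩

/-- Proposition 4.1: `S₅` preserves the set `ℛ = {± r_λ}` — indeed
`π · r_λ = ± r_{π(λ)}` — and acts transitively on it. -/
theorem S5_action_on_characteristic_functions :
    (∀ π : Equiv.Perm (Fin 5), ∀ p q : Fin 5, p < q →
      permAct π (rfun p q) = sortedR (π p) (π q) ∨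
      permAct π (rfun p q) = fun v => -(sortedR (π p) (π q) v)) ∧
    (∀ π : Equiv.Perm (Fin 5), ∀ f ∈ Rset, permAct π f ∈ Rset) ∧
    (∀ f ∈ Rset, ∀ g ∈ Rset, ∃ π : Equiv.Perm (Fin 5), permAct π f = g) := by
  refine ⟨part_one, ?_, ?_⟩
  · rintro σ f ⟨p, q, hpq, rfl | rfl⟩
    · have hm := sortedR_mem (σ.injective.ne hpq.ne)
      rcases part_one σ p q hpq with h | h
      · rw [h]; exact hm.1
      · rw [h]; exact hm.2
    · have hm := sortedR_mem (σ.injective.ne hpq.ne)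
      rw [permAct_negf]
      rcases part_one σ p q hpq with h | h
      · rw [h]; exact hm.2
      · rw [h]; simpa only [neg_neg] using hm.1
  · intro f hf g hg
    obtain ⟨σ, rfl⟩ := reach hf
    obtain ⟨τ, rfl⟩ := reach hg
    exact ⟨τ * σ⁻¹, by rw [← permAct_mul, inv_mul_cancel_right]⟩
end

section
/- (Criterion for Möbius structures.) A sub-Möbius structure M on a set X is a Möbius structure if and only if for every scale triple A = (α, β, ω) ∈ X³ and every admissible 5-tuple P = (x, y, α, β, ω) the following hold, writing M(P_i) = (a(P_i), b(P_i), c(P_i)): (A) b(P_1) + b(P_4) = b(P_3) − a(P_1) for all y ∈ X with y ≠ α, β; and (B) b(P_2) = −a(P_4) + b(P_1) for y ≠ α, ω. Here equalities involving infinite values use the convention (a + ∞) − (b + ∞) = 0. -/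
open Equiv

open scoped ENNReal

/-- A semi-metric on `X`: a symmetric function `d : X² → [0,∞]` vanishing exactly on the
diagonal, having at most one infinitely remote point `ω` (distances to `ω` from points
`≠ ω` are `∞`, and all other distances are finite). -/
structure SemiMetric (X : Type*) where
  d : X → X → ℝ≥0∞
  symm : ∀ x y, d x y = d y x
  eq_zero_iff : ∀ x y, d x y = 0 ↔ x = y
  remote : ∃ S : Set X, S.Subsingleton ∧ ∀ x y, x ≠ y → (d x y = ⊤ ↔ x ∈ S ∨ y ∈ S)

/-- The "Gromov product" `(x|y) = −ln d(x,y) ∈ [−∞,∞]`. -/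
noncomputable def ip {X : Type*} (m : SemiMetric X) (x y : X) : EReal :=
  - (m.d x y).log

open Classical in
/-- Difference `u - v` in `[−∞,∞]` with the agreement that two equal infinities cancel:
`(∞) − (∞) = 0 = (−∞) − (−∞)`. -/
noncomputable def cd2 (u v : EReal) : EReal :=
  if (u = ⊤ ∨ u = ⊥) ∧ u = v then 0 else u - v

open Classical in
/-- The combination `(p + q) − (r + s)` in `[−∞,∞]`, computed with the agreement of the
paper (`(a+∞) − (b+∞) = 0`): an infinite term on the positive side cancels against an
equal infinite term on the negative side. -/
noncomputable def cd4 (p q r s : EReal) : EReal :=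
  if (p = ⊤ ∨ p = ⊥) ∧ p = r then cd2 q s
  else if (p = ⊤ ∨ p = ⊥) ∧ p = s then cd2 q r
  else if (q = ⊤ ∨ q = ⊥) ∧ q = r then cd2 p s
  else if (q = ⊤ ∨ q = ⊥) ∧ q = s then cd2 p r
  else (p + q) - (r + s)

/-- The Möbius structure `M_d` associated with a semi-metric `d`:
`M_d(x₁,x₂,x₃,x₄) = (a,b,c)` with
`a = (x₁|x₄)+(x₂|x₃)−(x₁|x₃)−(x₂|x₄)`,
`b = (x₁|x₂)+(x₃|x₄)−(x₁|x₄)−(x₂|x₃)`,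
`c = (x₂|x₄)+(x₁|x₃)−(x₁|x₂)−(x₃|x₄)`. -/
noncomputable def Md {X : Type*} (m : SemiMetric X) (Q : Fin 4 → X) : Fin 3 → EReal :=
  ![cd4 (ip m (Q 0) (Q 3)) (ip m (Q 1) (Q 2)) (ip m (Q 0) (Q 2)) (ip m (Q 1) (Q 3)),
    cd4 (ip m (Q 0) (Q 1)) (ip m (Q 2) (Q 3)) (ip m (Q 0) (Q 3)) (ip m (Q 1) (Q 2)),
    cd4 (ip m (Q 1) (Q 3)) (ip m (Q 0) (Q 2)) (ip m (Q 0) (Q 1)) (ip m (Q 2) (Q 3))]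

/-- A 4-tuple is admissible if it contains at most two equal entries
(no value occurs three or more times). -/
def Admissible4 {X : Type*} (Q : Fin 4 → X) : Prop :=
  ∀ i j k : Fin 4, i ≠ j → i ≠ k → j ≠ k → ¬(Q i = Q j ∧ Q i = Q k)

/-- The plane `L₄ ⊂ ℝ³` of triples with `a + b + c = 0`, viewed inside `[−∞,∞]³`. -/
def L4set : Set (Fin 3 → EReal) :=
  {p | ∃ u : Fin 3 → ℝ, u 0 + u 1 + u 2 = 0 ∧ p = fun j => (u j : EReal)}

/-- The extension `L̄₄ = L₄ ∪ {A, B, C}` by the three infinitely remote points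
`A = (0,∞,−∞)`, `B = (−∞,0,∞)`, `C = (∞,−∞,0)`. -/
def Lbar4 : Set (Fin 3 → EReal) :=
  L4set ∪ {![0, ⊤, ⊥], ![⊥, 0, ⊤], ![⊤, ⊥, 0]}

open Classical in
/-- The signed action of `σ ∈ S₃` (with sign `ε`) on `[−∞,∞]³`: coordinates are permuted
by `σ` and multiplied by `−1` when `ε = −1`. -/
noncomputable def signedAct3 (ε : ℤˣ) (σ : Equiv.Perm (Fin 3)) (p : Fin 3 → EReal) :
    Fin 3 → EReal :=
  fun j => if ε = 1 then p (σ⁻¹ j) else - p (σ⁻¹ j)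

/-- A sub-Möbius structure on `X`: a map `M` on admissible 4-tuples with values in
`L̄₄ ⊂ [−∞,∞]³` such that (a) `M(πQ) = sign(π) φ(π) M(Q)` for the signed cross-ratio
homomorphism; (b) `M(Q) ∈ L₄` iff `Q` is nondegenerate; (c) `M(x₁,x₁,x₃,x₄) = (0,∞,−∞)`.
(The map is defined on all 4-tuples; only its values on admissible tuples are constrained.) -/
structure SubMoebius (X : Type*) where
  M : (Fin 4 → X) → Fin 3 → EReal
  mem_Lbar : ∀ Q, Admissible4 Q → M Q ∈ Lbar4
  equivariant : ∀ Q, Admissible4 Q → ∀ π : Equiv.Perm (Fin 4),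
    M (fun k => Q (π⁻¹ k)) = signedAct3 (Equiv.Perm.sign π) (phi π) (M Q)
  mem_L4_iff : ∀ Q, Admissible4 Q → (M Q ∈ L4set ↔ Function.Injective Q)
  diag : ∀ x z w : X, Admissible4 ![x, x, z, w] → M ![x, x, z, w] = ![0, ⊤, ⊥]

/-- A sub-Möbius structure is a Möbius structure if it is generated by a semi-metric. -/
def IsMoebius {X : Type*} (S : SubMoebius X) : Prop :=
  ∃ m : SemiMetric X, ∀ Q, Admissible4 Q → S.M Q = Md m Q

/-- `del P i = P_i`, the 4-tuple obtained from the 5-tuple `P` by deleting the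
`i`-th entry. -/
def del {X : Type*} (P : Fin 5 → X) (i : Fin 5) : Fin 4 → X :=
  fun k => P (i.succAbove k)

/-- A 5-tuple is admissible if all its 4-subtuples are admissible. -/
def Admissible5 {X : Type*} (P : Fin 5 → X) : Prop :=
  ∀ i, Admissible4 (del P i)

section Helpers

/-- Four pairwise distinct points. -/
def D4 {X : Type*} (x y z w : X) : Prop :=
  x ≠ y ∧ x ≠ z ∧ x ≠ w ∧ y ≠ z ∧ y ≠ w ∧ z ≠ w

/-- No value occurs three times among four points. -/
def Ad {X : Type*} (x y z w : X) : Prop :=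
  ¬(x = y ∧ x = z) ∧ ¬(x = y ∧ x = w) ∧ ¬(x = z ∧ x = w) ∧ ¬(y = z ∧ y = w)

lemma ad_iff {X : Type*} (x y z w : X) : Admissible4 ![x, y, z, w] ↔ Ad x y z w := by
  constructor
  · intro h
    exact ⟨h 0 1 2 (by decide) (by decide) (by decide), h 0 1 3 (by decide) (by decide) (by decide),
      h 0 2 3 (by decide) (by decide) (by decide), h 1 2 3 (by decide) (by decide) (by decide)⟩
  · rintro ⟨h1, h2, h3, h4⟩ i j k hij hik hjk
    fin_cases i <;> fin_cases j <;> fin_cases k <;> simp at hij hik hjk ⊢ <;> grind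

lemma inj_iff {X : Type*} (x y z w : X) : Function.Injective ![x, y, z, w] ↔ D4 x y z w := by
  constructor
  · intro h
    have key : ∀ i j : Fin 4, i ≠ j → ![x, y, z, w] i ≠ ![x, y, z, w] j := fun i j hij e => hij (h e)
    exact ⟨key 0 1 (by decide), key 0 2 (by decide), key 0 3 (by decide), key 1 2 (by decide),
      key 1 3 (by decide), key 2 3 (by decide)⟩
  · rintro ⟨h1, h2, h3, h4, h5, h6⟩ i j hij
    fin_cases i <;> fin_cases j <;> simp at hij ⊢ <;> grind

lemma D4.ad {X : Type*} {x y z w : X} (h : D4 x y z w) : Ad x y z w := by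
  unfold D4 at h; unfold Ad; grind

lemma eta4 {X : Type*} (Q : Fin 4 → X) : Q = ![Q 0, Q 1, Q 2, Q 3] := by
  funext i; fin_cases i <;> rfl

lemma M_swap {X : Type*} (S : SubMoebius X) (Q Q' : Fin 4 → X) (h : Admissible4 Q) (i j : Fin 4)
    (hij : i ≠ j) (hQ : Q' = fun k => Q (Equiv.swap i j k)) (t : Fin 3) :
    S.M Q' t = - S.M Q ((phi (Equiv.swap i j))⁻¹ t) := by
  have h1 := S.equivariant Q h (Equiv.swap i j)
  rw [Equiv.swap_inv] at h1
  rw [hQ, h1]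
  simp [signedAct3, Equiv.Perm.sign_swap hij]

lemma M_s01 {X : Type*} (S : SubMoebius X) {x y z w : X} (h : Ad x y z w) :
    S.M ![y, x, z, w] = ![- S.M ![x, y, z, w] 0, - S.M ![x, y, z, w] 2, - S.M ![x, y, z, w] 1] := by
  have key := M_swap S ![x, y, z, w] ![y, x, z, w] ((ad_iff _ _ _ _).2 h) 0 1 (by decide)
    (by funext i; fin_cases i <;> rfl)
  funext t
  rw [key t]
  fin_cases t <;> rfl

lemma M_s12 {X : Type*} (S : SubMoebius X) {x y z w : X} (h : Ad x y z w) :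
    S.M ![x, z, y, w] = ![- S.M ![x, y, z, w] 1, - S.M ![x, y, z, w] 0, - S.M ![x, y, z, w] 2] := by
  have key := M_swap S ![x, y, z, w] ![x, z, y, w] ((ad_iff _ _ _ _).2 h) 1 2 (by decide)
    (by funext i; fin_cases i <;> rfl)
  funext t
  rw [key t]
  fin_cases t <;> rfl

lemma M_s23 {X : Type*} (S : SubMoebius X) {x y z w : X} (h : Ad x y z w) :
    S.M ![x, y, w, z] = ![- S.M ![x, y, z, w] 0, - S.M ![x, y, z, w] 2, - S.M ![x, y, z, w] 1] := by
  have key := M_swap S ![x, y, z, w] ![x, y, w, z] ((ad_iff _ _ _ _).2 h) 2 3 (by decide)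
    (by funext i; fin_cases i <;> rfl)
  funext t
  rw [key t]
  fin_cases t <;> rfl

/-! Degenerate values. -/

lemma M_deg01 {X : Type*} (S : SubMoebius X) {x z w : X} (h : Ad x x z w) :
    S.M ![x, x, z, w] = ![0, ⊤, ⊥] := S.diag x z w ((ad_iff _ _ _ _).2 h)

lemma M_deg02 {X : Type*} (S : SubMoebius X) {x z w : X} (h : Ad x z x w) :
    S.M ![x, z, x, w] = ![⊥, 0, ⊤] := by
  have h' : Ad x x z w := by unfold Ad at *; grind
  rw [M_s12 S h', M_deg01 S h']; simp

lemma M_deg12 {X : Type*} (S : SubMoebius X) {x z w : X} (h : Ad z x x w) :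
    S.M ![z, x, x, w] = ![⊤, ⊥, 0] := by
  have h' : Ad x z x w := by unfold Ad at *; grind
  rw [M_s01 S h', M_deg02 S h']; simp

lemma M_deg03 {X : Type*} (S : SubMoebius X) {x z w : X} (h : Ad x z w x) :
    S.M ![x, z, w, x] = ![⊤, ⊥, 0] := by
  have h' : Ad x z x w := by unfold Ad at *; grind
  rw [M_s23 S h', M_deg02 S h']; simp

lemma M_deg13 {X : Type*} (S : SubMoebius X) {x z w : X} (h : Ad z x w x) :
    S.M ![z, x, w, x] = ![⊥, 0, ⊤] := by
  have h' : Ad z x x w := by unfold Ad at *; grind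
  rw [M_s23 S h', M_deg12 S h']; simp

lemma M_deg23 {X : Type*} (S : SubMoebius X) {x z w : X} (h : Ad z w x x) :
    S.M ![z, w, x, x] = ![0, ⊤, ⊥] := by
  have h' : Ad z x w x := by unfold Ad at *; grind
  rw [M_s12 S h', M_deg13 S h']; simp

/-! Nondegenerate values. -/

/-- The real `b`-coordinate. -/
noncomputable def Bf {X : Type*} (S : SubMoebius X) (x y z w : X) : ℝ :=
  (S.M ![x, y, z, w] 1).toReal

lemma M_real {X : Type*} (S : SubMoebius X) {x y z w : X} (h : D4 x y z w) :
    ∃ a b c : ℝ, a + b + c = 0 ∧ S.M ![x, y, z, w] = ![(a : EReal), (b : EReal), (c : EReal)] := by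
  obtain ⟨u, hu, hM⟩ := (S.mem_L4_iff _ ((ad_iff _ _ _ _).2 h.ad)).2 ((inj_iff _ _ _ _).2 h)
  refine ⟨u 0, u 1, u 2, hu, ?_⟩
  rw [hM]; funext t; fin_cases t <;> rfl

lemma M_eq {X : Type*} (S : SubMoebius X) {x y z w : X} (h : D4 x y z w) :
    S.M ![x, y, z, w] = ![((-Bf S x z y w : ℝ) : EReal), ((Bf S x y z w : ℝ) : EReal),
      ((-Bf S y x z w : ℝ) : EReal)] := by
  obtain ⟨a, b, c, -, hM⟩ := M_real S h
  simp only [Bf]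
  rw [M_s12 S h.ad, M_s01 S h.ad, hM]
  simp

lemma Bf_sum {X : Type*} (S : SubMoebius X) {x y z w : X} (h : D4 x y z w) :
    Bf S x y z w = Bf S x z y w + Bf S y x z w := by
  obtain ⟨a, b, c, hs, hM⟩ := M_real S h
  simp only [Bf]
  rw [M_s12 S h.ad, M_s01 S h.ad, hM]
  simp
  linarith

lemma Bf_dbl {X : Type*} (S : SubMoebius X) {x y z w : X} (h : D4 x y z w) :
    Bf S y x w z = Bf S x y z w := by
  obtain ⟨a, b, c, hs, hM⟩ := M_real S h
  have h' : Ad y x z w := by unfold D4 at h; unfold Ad; grind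
  simp only [Bf]
  rw [M_s23 S h', M_s01 S h.ad, hM]
  simp

lemma Bf_s02 {X : Type*} (S : SubMoebius X) {x y z w : X} (h : D4 x y z w) :
    Bf S z y x w = - Bf S x y z w := by
  obtain ⟨a, b, c, hs, hM⟩ := M_real S h
  have h1 : Ad y x z w := by unfold D4 at h; unfold Ad; grind
  have h2 : Ad y z x w := by unfold D4 at h; unfold Ad; grind
  simp only [Bf]
  rw [M_s01 S h2, M_s12 S h1, M_s01 S h.ad, hM]
  simp

/-! The structure of a semi-metric. -/

lemma ip_symm {X : Type*} (m : SemiMetric X) (x y : X) : ip m x y = ip m y x := by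
  simp [ip, m.symm x y]

lemma ip_top {X : Type*} (m : SemiMetric X) (x y : X) : ip m x y = ⊤ ↔ x = y := by
  rw [← m.eq_zero_iff]; simp [ip]

lemma ip_self {X : Type*} (m : SemiMetric X) (x : X) : ip m x x = ⊤ := (ip_top m x x).2 rfl

lemma ip_bot {X : Type*} (m : SemiMetric X) : ∃ T : Set X, T.Subsingleton ∧
    ∀ x y, x ≠ y → (ip m x y = ⊥ ↔ x ∈ T ∨ y ∈ T) := by
  obtain ⟨T, h1, h2⟩ := m.remote
  refine ⟨T, h1, fun x y hxy => ?_⟩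
  rw [← h2 x y hxy]; simp [ip]

lemma cd4_real (p q r s : ℝ) :
    cd4 (p : EReal) q r s = ((p + q - r - s : ℝ) : EReal) := by
  simp only [cd4, EReal.coe_ne_top, EReal.coe_ne_bot]
  simp
  norm_cast
  ring_nf

lemma cd4_pr (q s : ℝ) : cd4 ⊥ (q : EReal) ⊥ s = ((q - s : ℝ) : EReal) := by
  simp [cd4, cd2]

lemma cd4_ps (q s : ℝ) : cd4 ⊥ (q : EReal) s ⊥ = ((q - s : ℝ) : EReal) := by
  simp [cd4, cd2]

lemma cd4_qr (q s : ℝ) : cd4 (q : EReal) ⊥ ⊥ s = ((q - s : ℝ) : EReal) := by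
  simp [cd4, cd2]

lemma cd4_qs (q s : ℝ) : cd4 (q : EReal) ⊥ s ⊥ = ((q - s : ℝ) : EReal) := by
  simp [cd4, cd2]

/-- Real valued Gromov product; infinite values are replaced by zero. -/
noncomputable def fr {X : Type*} (m : SemiMetric X) (x y : X) : ℝ := (ip m x y).toReal

lemma cd4_ip {X : Type*} (m : SemiMetric X) {x y z w : X} (h : D4 x y z w) :
    cd4 (ip m x y) (ip m z w) (ip m x w) (ip m y z) =
      ((fr m x y + fr m z w - fr m x w - fr m y z : ℝ) : EReal) := by
  obtain ⟨T, hT, hb⟩ := ip_bot m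
  obtain ⟨h1, h2, h3, h4, h5, h6⟩ := h
  have r : ∀ u v : X, u ≠ v → u ∉ T → v ∉ T → ip m u v = ((fr m u v : ℝ) : EReal) := by
    intro u v huv hu hv
    refine (EReal.coe_toReal ?_ ?_).symm
    · rw [Ne, ip_top]; exact huv
    · rw [Ne, hb u v huv]; tauto
  have i : ∀ u v : X, u ≠ v → (u ∈ T ∨ v ∈ T) → ip m u v = ⊥ := fun u v huv hu =>
    (hb u v huv).2 hu
  have z0 : ∀ u v : X, u ≠ v → (u ∈ T ∨ v ∈ T) → fr m u v = 0 := fun u v huv hu => by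
    simp [fr, i u v huv hu]
  by_cases hx : x ∈ T
  · have hy : y ∉ T := fun k => h1 (hT hx k)
    have hz : z ∉ T := fun k => h2 (hT hx k)
    have hw : w ∉ T := fun k => h3 (hT hx k)
    rw [i x y h1 (by tauto), i x w h3 (by tauto), r z w h6 hz hw, r y z h4 hy hz,
      z0 x y h1 (by tauto), z0 x w h3 (by tauto), cd4_pr]
    simp
  by_cases hy : y ∈ T
  · have hz : z ∉ T := fun k => h4 (hT hy k)
    have hw : w ∉ T := fun k => h5 (hT hy k)
    rw [i x y h1 (by tauto), i y z h4 (by tauto), r z w h6 hz hw, r x w h3 hx hw,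
      z0 x y h1 (by tauto), z0 y z h4 (by tauto), cd4_ps]
    simp
  by_cases hz : z ∈ T
  · have hw : w ∉ T := fun k => h6 (hT hz k)
    rw [i z w h6 (by tauto), i y z h4 (by tauto), r x y h1 hx hy, r x w h3 hx hw,
      z0 z w h6 (by tauto), z0 y z h4 (by tauto), cd4_qs]
    simp
  by_cases hw : w ∈ T
  · rw [i z w h6 (by tauto), i x w h3 (by tauto), r x y h1 hx hy, r y z h4 hy hz,
      z0 z w h6 (by tauto), z0 x w h3 (by tauto), cd4_qr]
    simp
  rw [r x y h1 hx hy, r z w h6 hz hw, r x w h3 hx hw, r y z h4 hy hz, cd4_real]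

lemma fr_symm {X : Type*} (m : SemiMetric X) (x y : X) : fr m x y = fr m y x := by
  simp [fr, ip_symm m x y]

lemma Md_nd {X : Type*} (m : SemiMetric X) {x y z w : X} (h : D4 x y z w) :
    Md m ![x, y, z, w] =
      ![((fr m x w + fr m y z - fr m x z - fr m y w : ℝ) : EReal),
        ((fr m x y + fr m z w - fr m x w - fr m y z : ℝ) : EReal),
        ((fr m y w + fr m x z - fr m x y - fr m z w : ℝ) : EReal)] := by
  have ha : D4 x w y z := by unfold D4 at *; grind
  have hc : D4 y w x z := by unfold D4 at *; grind
  have e1 := cd4_ip m ha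
  have e2 := cd4_ip m h
  have e3 := cd4_ip m hc
  rw [ip_symm m w y, fr_symm m w y] at e1
  have e3' : cd4 (ip m y w) (ip m x z) (ip m x y) (ip m z w) =
      ((fr m y w + fr m x z - fr m x y - fr m z w : ℝ) : EReal) := by
    have hc : D4 w y x z := by unfold D4 at *; grind
    have e3 := cd4_ip m (x := w) (y := y) (z := x) (w := z) hc
    have hc2 : D4 y w z x := by unfold D4 at *; grind
    have e4 := cd4_ip m hc2
    rw [ip_symm m z x, fr_symm m z x, ip_symm m y x, fr_symm m y x, ip_symm m w z,
      fr_symm m w z] at e4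
    exact e4
  show ![_, _, _] = _
  simp only [Matrix.cons_val]
  rw [e1, e2, e3']

/-! Degenerate values of `Md`. -/

lemma cd4_zero1 (p q : EReal) : cd4 p q q p = 0 := by
  induction p <;> induction q <;> simp [cd4, cd2]
  norm_cast
  ring_nf

lemma cd4_zero2 (p q : EReal) : cd4 p q p q = 0 := by
  induction p <;> induction q <;> simp [cd4, cd2]
  norm_cast
  ring_nf

lemma cd4_top1 (q r s : EReal) (hr : r ≠ ⊤) (hs : s ≠ ⊤) (hq : q = ⊥ → r = ⊥ ∨ s = ⊥) :
    cd4 ⊤ q r s = ⊤ := by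
  induction q <;> induction r <;> induction s <;> simp_all [cd4, cd2] <;> norm_cast

lemma cd4_top2 (q r s : EReal) (hr : r ≠ ⊤) (hs : s ≠ ⊤) (hq : q = ⊥ → r = ⊥ ∨ s = ⊥) :
    cd4 q ⊤ r s = ⊤ := by
  induction q <;> induction r <;> induction s <;> simp_all [cd4, cd2] <;> norm_cast

lemma cd4_bot1 (q r s : EReal) (hr : r ≠ ⊤) (hs : s ≠ ⊤) (hq : q = ⊥ → r = ⊥ ∨ s = ⊥) :
    cd4 r s ⊤ q = ⊥ := by
  induction q <;> induction r <;> induction s <;> simp_all [cd4, cd2] <;> norm_cast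

lemma cd4_bot2 (q r s : EReal) (hr : r ≠ ⊤) (hs : s ≠ ⊤) (hq : q = ⊥ → r = ⊥ ∨ s = ⊥) :
    cd4 r s q ⊤ = ⊥ := by
  induction q <;> induction r <;> induction s <;> simp_all [cd4, cd2] <;> norm_cast

lemma ip_tri {X : Type*} (m : SemiMetric X) {x z w : X} (hz : x ≠ z) (hw : x ≠ w)
    (h : ip m z w = ⊥) : ip m x z = ⊥ ∨ ip m x w = ⊥ := by
  obtain ⟨T, -, hb⟩ := ip_bot m
  have hzw : z ≠ w := by
    rintro rfl; rw [ip_self] at h; simp at h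
  rw [hb _ _ hz, hb _ _ hw]
  rw [hb _ _ hzw] at h
  tauto

lemma Md_deg {X : Type*} (m : SemiMetric X) (S : SubMoebius X) {x y z w : X} (h : Ad x y z w)
    (hn : ¬ D4 x y z w) : S.M ![x, y, z, w] = Md m ![x, y, z, w] := by
  have nt : ∀ {u v : X}, u ≠ v → ip m u v ≠ ⊤ := fun huv => by rwa [Ne, ip_top]
  have tri : ∀ {u v t : X}, u ≠ v → u ≠ t → ip m v t = ⊥ → ip m u v = ⊥ ∨ ip m u t = ⊥ :=
    fun h1 h2 h3 => ip_tri m h1 h2 h3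
  have h0 := h
  obtain ⟨h1, h2, h3, h4⟩ := h0
  by_cases e : x = y
  · subst e
    have a1 : x ≠ z := by grind
    have a2 : x ≠ w := by grind
    rw [M_deg01 S h]
    have t := tri a1 a2
    simp only [Md, Matrix.cons_val, ip_self]
    rw [cd4_zero1, cd4_top1 _ _ _ (nt a2) (nt a1) (fun k => (t k).symm),
      cd4_bot1 _ _ _ (nt a2) (nt a1) (fun k => (t k).symm)]
  by_cases e : x = z
  · subst e
    have a1 : x ≠ y := by grind
    have a2 : x ≠ w := by grind
    rw [M_deg02 S h]
    have t := tri a1 a2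
    simp only [Md, Matrix.cons_val, ip_self]
    rw [ip_symm m y x, cd4_zero1, cd4_top2 _ _ _ (nt a1) (nt a2) t,
      cd4_bot1 _ _ _ (nt a2) (nt a1) (fun k => (t k).symm)]
  by_cases e : x = w
  · subst e
    have a1 : x ≠ y := by grind
    have a2 : x ≠ z := by grind
    rw [M_deg03 S h]
    have t := tri a1 a2
    simp only [Md, Matrix.cons_val, ip_self]
    rw [ip_symm m y x, ip_symm m z x, cd4_zero2, cd4_top1 _ _ _ (nt a2) (nt a1) (fun k => (t k).symm),
      cd4_bot1 _ _ _ (nt a1) (nt a2) t]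
  by_cases e : y = z
  · subst e
    have a1 : y ≠ x := by grind
    have a2 : y ≠ w := by grind
    rw [M_deg12 S h]
    have t := tri a1 a2
    simp only [Md, Matrix.cons_val, ip_self]
    rw [ip_symm m x y, cd4_zero1, cd4_top2 _ _ _ (nt a1) (nt a2) t,
      cd4_bot2 _ _ _ (nt a1) (nt a2) t]
  by_cases e : y = w
  · subst e
    have a1 : y ≠ x := by grind
    have a2 : y ≠ z := by grind
    rw [M_deg13 S h]
    have t := tri a1 a2
    simp only [Md, Matrix.cons_val, ip_self]
    rw [ip_symm m x y, ip_symm m z y, cd4_zero2, cd4_top1 _ _ _ (nt a1) (nt a2) t,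
      cd4_bot2 _ _ _ (nt a1) (nt a2) t]
  by_cases e : z = w
  · subst e
    have a1 : z ≠ x := by grind
    have a2 : z ≠ y := by grind
    rw [M_deg23 S h]
    have t := tri a1 a2
    simp only [Md, Matrix.cons_val, ip_self]
    rw [ip_symm m x z, ip_symm m y z, cd4_zero2, cd4_top2 _ _ _ (nt a1) (nt a2) t,
      cd4_bot2 _ _ _ (nt a2) (nt a1) (fun k => (t k).symm)]
  exact absurd (by unfold D4; grind) hn

lemma moebius_of {X : Type*} (m : SemiMetric X) (S : SubMoebius X)
    (h : ∀ x y z w, D4 x y z w →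
      Bf S x y z w = fr m x y + fr m z w - fr m x w - fr m y z) : IsMoebius S := by
  refine ⟨m, fun Q hQ => ?_⟩
  rw [eta4 Q] at hQ ⊢
  rw [ad_iff] at hQ
  by_cases hn : D4 (Q 0) (Q 1) (Q 2) (Q 3)
  · rw [M_eq S hn, Md_nd m hn, h _ _ _ _ hn, h (Q 0) (Q 2) (Q 1) (Q 3) (by unfold D4 at *; grind),
      h (Q 1) (Q 0) (Q 2) (Q 3) (by unfold D4 at *; grind)]
    have s1 := fr_symm m (Q 1) (Q 2)
    have s2 := fr_symm m (Q 0) (Q 1)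
    congr 2
    · rw [s1]; congr 1; ring
    · congr 1
      rw [s2]; congr 1; ring
  · exact Md_deg m S hQ hn

/-- Build a semi-metric from its Gromov product. -/
noncomputable def mkSemi {X : Type*} (g : X → X → EReal) (hs : ∀ x y, g x y = g y x)
    (ht : ∀ x y, g x y = ⊤ ↔ x = y)
    (hr : ∃ T : Set X, T.Subsingleton ∧ ∀ x y, x ≠ y → (g x y = ⊥ ↔ x ∈ T ∨ y ∈ T)) :
    SemiMetric X where
  d x y := EReal.exp (- g x y)
  symm x y := by rw [hs]
  eq_zero_iff x y := by rw [← ht]; simp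
  remote := by
    obtain ⟨T, h1, h2⟩ := hr
    refine ⟨T, h1, fun x y hxy => ?_⟩
    rw [← h2 x y hxy]; simp

lemma ip_mkSemi {X : Type*} (g : X → X → EReal) (hs ht hr) (x y : X) :
    ip (mkSemi g hs ht hr) x y = g x y := by
  simp [ip, mkSemi]

/-! The abstract reconstruction. -/

lemma recon {X : Type*} (B : X → X → X → X → ℝ) (α β ω : X)
    (hαβ : α ≠ β) (hαω : α ≠ ω) (hβω : β ≠ ω)
    (K1 : ∀ {x y z w}, D4 x y z w → B y x w z = B x y z w)
    (K2 : ∀ {x y z w}, D4 x y z w → B z y x w = - B x y z w)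
    (K3 : ∀ {x y z w}, D4 x y z w → B x y z w = B x z y w + B y x z w)
    (KA : ∀ x y α β ω, D4 y α β ω → x ≠ y → x ≠ α → x ≠ β → x ≠ ω →
      B y α β ω + B x y α ω = B x y β ω + B y β α ω)
    (KB : ∀ x y α β ω, D4 y α β ω → x ≠ y → x ≠ α → x ≠ β → x ≠ ω →
      B x α β ω = B x α y ω + B y α β ω) :
    ∃ f : X → X → ℝ, (∀ x y, x ≠ y → f x y = f y x) ∧ (∀ x, x ≠ ω → f x ω = 0) ∧
      ∀ x y z w, D4 x y z w → B x y z w = f x y + f z w - f x w - f y z := by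
  classical
  obtain ⟨h, hh⟩ : ∃ h : X → ℝ, ∀ x, h x = if x = β then 0 else B x α β ω := ⟨_, fun _ => rfl⟩
  have hB : ∀ x y, D4 x y α ω → h x = B x α y ω + h y := by
    intro x y hd
    rw [hh, hh]
    obtain ⟨d1, d2, d3, d4, d5, d6⟩ := hd
    split_ifs with e1 e2 e2
    · exact absurd (e1.trans e2.symm) d1
    · subst e1
      have := K2 (x := x) (y := α) (z := y) (w := ω) (by unfold D4; grind)
      linarith
    · subst e2; ring
    · exact KB x y α β ω (by unfold D4; grind) d1 d2 e1 d3
  obtain ⟨f, hf⟩ : ∃ f : X → X → ℝ, ∀ x y, f x y = if x = ω ∨ y = ω then 0 else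
    if y = α then h x else if x = α then h y else B x y α ω + h y := ⟨_, fun _ _ => rfl⟩
  have fs : ∀ x y, x ≠ y → f x y = f y x := by
    intro x y hxy
    rw [hf, hf]
    by_cases e1 : x = ω
    · simp [e1]
    by_cases e2 : y = ω
    · simp [e2]
    by_cases e3 : x = α
    · subst e3; simp [e1, e2, hxy.symm]
    by_cases e4 : y = α
    · subst e4; simp [e1, e2, hxy]
    simp only [e1, e2, e3, e4, if_false, or_self]
    have hd : D4 x y α ω := by unfold D4; grind
    have k1 := hB x y hd
    have k2 := K3 hd
    have k3 := K3 (x := y) (y := x) (z := α) (w := ω) (by unfold D4 at *; grind)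
    linarith
  have fω : ∀ x, f x ω = 0 := fun x => by rw [hf]; simp
  have fω' : ∀ x, f ω x = 0 := fun x => by rw [hf]; simp
  -- tuples with last entry `ω`
  have fα : ∀ x y, D4 x y α ω → B x y α ω = f x y - f y α := by
    rintro x y ⟨d1, d2, d3, d4, d5, d6⟩
    rw [hf, hf]; simp [d2, d3, d4, d5, d6]
  have last : ∀ x y z, D4 x y z ω → B x y z ω = f x y - f y z := by
    intro x y z hd
    have hd0 := hd
    obtain ⟨d1, d2, d3, d4, d5, d6⟩ := hd
    by_cases e1 : z = α
    · subst e1; exact fα x y hd0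
    by_cases e2 : y = α
    · subst e2
      have k := hB x z (by unfold D4; grind)
      rw [fs y z d4, hf, hf]; simp [d1, d3, d5, d6]
      linarith
    by_cases e3 : x = α
    · subst e3
      have k := fα z y (by unfold D4; grind)
      rw [K2 (x := z) (y := y) (z := x) (w := ω) (by unfold D4; grind), k, fs z y d4.symm,
        fs y x d1.symm]
      ring
    have k := KA x y α z ω (by unfold D4; grind) d1 e3 d2 d3
    have k1 := fα x y (by unfold D4; grind)
    have k2 := fα z y (by unfold D4; grind)
    have k3 := K3 (x := y) (y := α) (z := z) (w := ω) (by unfold D4; grind)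
    have k4 := K2 (x := z) (y := y) (z := α) (w := ω) (by unfold D4; grind)
    have k5 := fs z y d4.symm
    linarith
  refine ⟨f, fs, fun x _ => fω x, ?_⟩
  -- tuples with first entry `ω`
  have first : ∀ y z w, D4 ω y z w → B ω y z w = f z w - f y z := by
    rintro y z w ⟨d1, d2, d3, d4, d5, d6⟩
    have k1 := K2 (x := z) (y := y) (z := ω) (w := w) (by unfold D4; grind)
    have k2 := K1 (x := z) (y := y) (z := ω) (w := w) (by unfold D4; grind)
    have l1 := last y z w (by unfold D4; grind)
    linarith
  intro x y z w hd
  obtain ⟨d1, d2, d3, d4, d5, d6⟩ := hd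
  by_cases e1 : w = ω
  · subst e1
    rw [last x y z (by unfold D4; grind), fω, fω]; ring
  by_cases e2 : x = ω
  · subst e2
    rw [first y z w (by unfold D4; grind), fω', fω']; ring
  by_cases e3 : y = ω
  · subst e3
    rw [← K1 (x := x) (y := y) (z := z) (w := w) (by unfold D4; grind),
      first x w z (by unfold D4; grind), fω, fω', fs w z d6.symm]; ring
  by_cases e4 : z = ω
  · subst e4
    rw [K2 (x := z) (y := y) (z := x) (w := w) (by unfold D4; grind),
      first y x w (by unfold D4; grind), fω, fω', fs y x d1.symm]; ring
  have k := KA ω y x z w (by unfold D4; grind) (Ne.symm e3) (Ne.symm e2) (Ne.symm e4) (Ne.symm e1)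
  have l1 := first y x w (by unfold D4; grind)
  have l2 := first y z w (by unfold D4; grind)
  have k3 := K3 (x := y) (y := x) (z := z) (w := w) (by unfold D4; grind)
  have s1 := fs y x d1.symm
  linarith

/-! The two conditions in terms of explicit tuples. -/

lemma del0 {X : Type*} (x y α β ω : X) : del ![x, y, α, β, ω] 0 = ![y, α, β, ω] := by
  funext i; fin_cases i <;> rfl

lemma del1 {X : Type*} (x y α β ω : X) : del ![x, y, α, β, ω] 1 = ![x, α, β, ω] := by
  funext i; fin_cases i <;> rfl

lemma del2 {X : Type*} (x y α β ω : X) : del ![x, y, α, β, ω] 2 = ![x, y, β, ω] := by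
  funext i; fin_cases i <;> rfl

lemma del3 {X : Type*} (x y α β ω : X) : del ![x, y, α, β, ω] 3 = ![x, y, α, ω] := by
  funext i; fin_cases i <;> rfl

lemma del4 {X : Type*} (x y α β ω : X) : del ![x, y, α, β, ω] 4 = ![x, y, α, β] := by
  funext i; fin_cases i <;> rfl

lemma ad5 {X : Type*} (x y α β ω : X) : Admissible5 ![x, y, α, β, ω] ↔
    Ad y α β ω ∧ Ad x α β ω ∧ Ad x y β ω ∧ Ad x y α ω ∧ Ad x y α β := by
  unfold Admissible5
  simp only [Fin.forall_fin_succ, Fin.forall_fin_zero]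
  rw [← ad_iff, ← ad_iff, ← ad_iff, ← ad_iff, ← ad_iff, ← del0 x, ← del1 x y, ← del2 x y α,
    ← del3 x y α β, ← del4 x y α β ω]
  simp only [and_true]
  rfl

lemma condA {X : Type*} (S : SubMoebius X)
    (KA : ∀ x y α β ω, D4 y α β ω → x ≠ y → x ≠ α → x ≠ β → x ≠ ω →
      Bf S y α β ω + Bf S x y α ω = Bf S x y β ω + Bf S y β α ω)
    {x y α β ω : X} (h1 : α ≠ β) (h2 : α ≠ ω) (h3 : β ≠ ω)
    (p1 : Ad y α β ω) (p3 : Ad x y β ω) (p4 : Ad x y α ω) (y1 : y ≠ α) (y2 : y ≠ β) :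
    S.M ![y, α, β, ω] 1 + S.M ![x, y, α, ω] 1 = S.M ![x, y, β, ω] 1 - S.M ![y, α, β, ω] 0 := by
  by_cases e : y = ω
  · subst e
    rw [M_deg03 S p1, M_deg13 S p3, M_deg13 S p4]; simp
  have d : D4 y α β ω := by unfold D4; grind
  have hs := Bf_sum S d
  rw [M_eq S d]
  by_cases e1 : x = y
  · subst e1
    rw [M_deg01 S p3, M_deg01 S p4]; simp
  by_cases e2 : x = ω
  · subst e2
    rw [M_deg03 S p3, M_deg03 S p4]; simp
  by_cases e3 : x = α
  · subst e3
    rw [M_deg02 S p4, M_eq S (show D4 x y β ω by unfold D4; grind)]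
    simp
    norm_cast
    linarith
  by_cases e4 : x = β
  · subst e4
    rw [M_deg02 S p3, M_eq S (show D4 x y α ω by unfold D4; grind)]
    have k := Bf_s02 S (show D4 x y α ω by unfold D4; grind)
    simp
    norm_cast
    linarith
  rw [M_eq S (show D4 x y α ω by unfold D4; grind), M_eq S (show D4 x y β ω by unfold D4; grind)]
  have k := KA x y α β ω d e1 e3 e4 e2
  simp
  norm_cast
  linarith

lemma condB {X : Type*} (S : SubMoebius X)
    (KB : ∀ x y α β ω, D4 y α β ω → x ≠ y → x ≠ α → x ≠ β → x ≠ ω →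
      Bf S x α β ω = Bf S x α y ω + Bf S y α β ω)
    {x y α β ω : X} (h1 : α ≠ β) (h2 : α ≠ ω) (h3 : β ≠ ω)
    (p1 : Ad y α β ω) (p2 : Ad x α β ω) (p4 : Ad x y α ω) (p3 : Ad x y β ω)
    (y1 : y ≠ α) (y2 : y ≠ ω) :
    S.M ![x, α, β, ω] 1 = - S.M ![x, y, α, ω] 0 + S.M ![y, α, β, ω] 1 := by
  obtain ⟨r, hr⟩ : ∃ r : ℝ, S.M ![y, α, β, ω] 1 = (r : EReal) := by
    by_cases e : y = β
    · subst e
      exact ⟨0, by rw [M_deg02 S p1]; simp⟩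
    · exact ⟨_, by rw [M_eq S (show D4 y α β ω by unfold D4; grind)]; rfl⟩
  by_cases e2 : x = ω
  · subst e2
    rw [M_deg03 S p2, M_deg03 S p4, hr]; simp
  by_cases e3 : x = α
  · subst e3
    rw [M_deg01 S p2, M_deg02 S p4, hr]; simp
  by_cases e1 : x = y
  · subst e1
    rw [M_deg01 S p4]; simp
  by_cases e : y = β
  · subst e
    rw [M_deg02 S p1, M_eq S (show D4 x y α ω by unfold D4; grind),
      M_eq S (show D4 x α y ω by unfold D4; grind)]
    simp
  have d : D4 y α β ω := by unfold D4; grind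
  by_cases e4 : x = β
  · subst e4
    rw [M_deg02 S p2, M_eq S d, M_eq S (show D4 x y α ω by unfold D4; grind)]
    have k := Bf_s02 S (show D4 x α y ω by unfold D4; grind)
    simp
    norm_cast
    linarith
  rw [M_eq S d, M_eq S (show D4 x y α ω by unfold D4; grind),
    M_eq S (show D4 x α β ω by unfold D4; grind)]
  have k := KB x y α β ω d e1 e3 e4 e2
  simp
  norm_cast

lemma Bf_of_moebius {X : Type*} (S : SubMoebius X) (m : SemiMetric X)
    (hm : ∀ Q, Admissible4 Q → S.M Q = Md m Q) {x y z w : X} (h : D4 x y z w) :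
    Bf S x y z w = fr m x y + fr m z w - fr m x w - fr m y z := by
  unfold Bf
  rw [hm _ ((ad_iff _ _ _ _).2 h.ad), Md_nd m h]
  rfl

end Helpers

/-- Theorem 2.3 (criterion for Möbius structures): a sub-Möbius structure `M` on `X` is a
Möbius structure if and only if for every scale triple `A = (α,β,ω)` of pairwise distinct
points and every admissible 5-tuple `P = (x,y,α,β,ω)`:
(A) `b(P₁) + b(P₄) = b(P₃) − a(P₁)` whenever `y ≠ α, β`, and
(B) `b(P₂) = −a(P₄) + b(P₁)` whenever `y ≠ α, ω`,
where `M(P_i) = (a(P_i), b(P_i), c(P_i))` and the arithmetic of `[−∞,∞]` incorporates the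
convention for infinite values. -/
theorem subMoebius_is_moebius_iff {X : Type*} (S : SubMoebius X) :
    IsMoebius S ↔
      ∀ α β ω : X, α ≠ β → α ≠ ω → β ≠ ω →
        ∀ x y : X, Admissible5 ![x, y, α, β, ω] →
          ((y ≠ α ∧ y ≠ β) →
            S.M (del ![x, y, α, β, ω] 0) 1 + S.M (del ![x, y, α, β, ω] 3) 1 =
              S.M (del ![x, y, α, β, ω] 2) 1 - S.M (del ![x, y, α, β, ω] 0) 0) ∧
          ((y ≠ α ∧ y ≠ ω) →
            S.M (del ![x, y, α, β, ω] 1) 1 =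
              - S.M (del ![x, y, α, β, ω] 3) 0 + S.M (del ![x, y, α, β, ω] 0) 1) := by
  constructor
  · rintro ⟨m, hm⟩ α β ω h1 h2 h3 x y hP
    obtain ⟨p1, p2, p3, p4, -⟩ := (ad5 _ _ _ _ _).1 hP
    simp only [del0, del1, del2, del3]
    have fs := fr_symm m
    constructor
    · rintro ⟨y1, y2⟩
      refine condA S ?_ h1 h2 h3 p1 p3 p4 y1 y2
      intro x y α β ω d e1 e2 e3 e4
      unfold D4 at d
      rw [Bf_of_moebius S m hm (show D4 y α β ω by unfold D4; grind),
        Bf_of_moebius S m hm (show D4 x y α ω by unfold D4; grind),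
        Bf_of_moebius S m hm (show D4 x y β ω by unfold D4; grind),
        Bf_of_moebius S m hm (show D4 y β α ω by unfold D4; grind), fs β α]
      ring
    · rintro ⟨y1, y2⟩
      refine condB S ?_ h1 h2 h3 p1 p2 p4 p3 y1 y2
      intro x y α β ω d e1 e2 e3 e4
      unfold D4 at d
      rw [Bf_of_moebius S m hm (show D4 y α β ω by unfold D4; grind),
        Bf_of_moebius S m hm (show D4 x α β ω by unfold D4; grind),
        Bf_of_moebius S m hm (show D4 x α y ω by unfold D4; grind), fs α y]
      ring
  · intro H
    classical
    by_cases hX : ∃ α β ω : X, α ≠ β ∧ α ≠ ω ∧ β ≠ ω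
    · obtain ⟨α, β, ω, h1, h2, h3⟩ := hX
      obtain ⟨f, fs, fω, hB⟩ := recon (Bf S) α β ω h1 h2 h3 (Bf_dbl S) (Bf_s02 S) (Bf_sum S)
        (by
          intro x y α β ω d e1 e2 e3 e4
          unfold D4 at d
          have k := (H α β ω (by grind) (by grind) (by grind) x y
            ((ad5 _ _ _ _ _).2 (by unfold Ad; grind))).1 (by grind)
          simp only [del0, del1, del2, del3] at k
          rw [M_eq S (show D4 y α β ω by unfold D4; grind),
            M_eq S (show D4 x y α ω by unfold D4; grind),
            M_eq S (show D4 x y β ω by unfold D4; grind)] at k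
          simp at k
          norm_cast at k
          linarith)
        (by
          intro x y α β ω d e1 e2 e3 e4
          unfold D4 at d
          have k := (H α β ω (by grind) (by grind) (by grind) x y
            ((ad5 _ _ _ _ _).2 (by unfold Ad; grind))).2 (by grind)
          simp only [del0, del1, del2, del3] at k
          rw [M_eq S (show D4 y α β ω by unfold D4; grind),
            M_eq S (show D4 x y α ω by unfold D4; grind),
            M_eq S (show D4 x α β ω by unfold D4; grind)] at k
          simp at k
          norm_cast at k)
      obtain ⟨g, hg⟩ : ∃ g : X → X → EReal, ∀ x y, g x y = if x = y then ⊤ else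
        if x = ω ∨ y = ω then ⊥ else (f x y : EReal) := ⟨_, fun _ _ => rfl⟩
      have gs : ∀ x y, g x y = g y x := by
        intro x y
        rw [hg, hg]
        by_cases e : x = y
        · simp [e]
        · simp only [e, Ne.symm e, if_false, fs x y e, or_comm]
      have gt : ∀ x y, g x y = ⊤ ↔ x = y := by
        intro x y
        rw [hg]
        split_ifs <;> simp_all
      have gb : ∃ T : Set X, T.Subsingleton ∧
          ∀ x y, x ≠ y → (g x y = ⊥ ↔ x ∈ T ∨ y ∈ T) := by
        refine ⟨{ω}, Set.subsingleton_singleton, fun x y hxy => ?_⟩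
        rw [hg]
        split_ifs <;> simp_all
      have key : ∀ x y, x ≠ y → fr (mkSemi g gs gt gb) x y = f x y := by
        intro x y hxy
        unfold fr
        rw [ip_mkSemi, hg, if_neg hxy]
        split_ifs with e
        · rcases e with e | e
          · subst e; rw [fs x y hxy, fω y hxy.symm]; rfl
          · subst e; rw [fω x hxy]; rfl
        · rfl
      refine moebius_of (mkSemi g gs gt gb) S fun x y z w d => ?_
      rw [hB x y z w d]
      obtain ⟨d1, d2, d3, d4, d5, d6⟩ := d
      rw [key x y d1, key z w d6, key x w d3, key y z d4]
    · refine moebius_of (mkSemi (fun x y => if x = y then ⊤ else 0) ?_ ?_ ?_) S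
        fun x y z w d => ?_
      · intro x y; simp only [eq_comm]
      · intro x y; simp
      · refine ⟨∅, Set.subsingleton_empty, fun x y hxy => ?_⟩
        simp [hxy]
      · exact absurd ⟨x, y, z, d.1, d.2.1, d.2.2.2.1⟩ hX
end

section
/- The symmetry set R̂ = ⋂_{λ∈Λ} {v ∈ L_5 : r_λ(v) = 0} is a 5-dimensional subspace of L_5; equivalently, the restrictions of the ten linear functionals r_λ to L_5 span a 5-dimensional space of functionals on the 10-dimensional space L_5. -/
/-- The subspace `L₅ ⊂ V⁵` of `5 × 3` matrices whose rows sum to zero. -/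
def L5sub : Submodule ℝ (Fin 5 → Fin 3 → ℝ) where
  carrier := {v | ∀ i, v i 0 + v i 1 + v i 2 = 0}
  zero_mem' := by intro i; simp
  add_mem' := by
    intro a b ha hb i
    have h1 := ha i; have h2 := hb i
    simp only [Pi.add_apply]; linarith
  smul_mem' := by
    intro c a ha i
    simp only [Pi.smul_apply, smul_eq_mul]
    linear_combination c * ha i

/-- The characteristic functional `r_λ` as a linear functional on `V⁵`. -/
def rlin (p q : Fin 5) : (Fin 5 → Fin 3 → ℝ) →ₗ[ℝ] ℝ where
  toFun := fun v => ∑ i, ∑ j, rc p q i j * v i j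
  map_add' := by
    intro v w
    rw [← Finset.sum_add_distrib]
    refine Finset.sum_congr rfl fun i _ => ?_
    rw [← Finset.sum_add_distrib]
    exact Finset.sum_congr rfl fun j _ => by simp [mul_add]
  map_smul' := by
    intro c v
    simp only [RingHom.id_apply, Pi.smul_apply, smul_eq_mul, Finset.mul_sum]
    exact Finset.sum_congr rfl fun i _ => Finset.sum_congr rfl fun j _ => by ring

/-- The symmetry set `R̂ = ⋂_{λ ∈ Λ} {v ∈ L₅ : r_λ(v) = 0}`, a subspace of `L₅`. -/
def Rhat : Submodule ℝ (Fin 5 → Fin 3 → ℝ) :=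
  L5sub ⊓ ⨅ (p : Fin 5), ⨅ (q : Fin 5), ⨅ (_ : p < q), LinearMap.ker (rlin p q)

/-- Membership in `R̂` as an explicit parametrization by `c₃, b₄, c₄, b₅, c₅`. -/
theorem mem_Rhat_iff (v : Fin 5 → Fin 3 → ℝ) : v ∈ Rhat ↔
    (v 0 0 = v 3 2 - v 4 2 ∧ v 0 1 = - v 2 2 - v 4 1 ∧
     v 0 2 = v 2 2 - v 3 2 + v 4 1 + v 4 2 ∧
     v 1 0 = - v 3 1 + v 4 1 ∧ v 1 1 = - v 2 2 + v 3 1 + v 3 2 - v 4 1 ∧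
     v 1 2 = v 2 2 - v 3 2 ∧
     v 2 0 = - v 3 1 - v 3 2 + v 4 1 + v 4 2 ∧
     v 2 1 = - v 2 2 + v 3 1 + v 3 2 - v 4 1 - v 4 2 ∧
     v 3 0 = - v 3 1 - v 3 2 ∧ v 4 0 = - v 4 1 - v 4 2) := by
  have hL : v ∈ L5sub ↔ ∀ i, v i 0 + v i 1 + v i 2 = 0 := Iff.rfl
  have hr : ∀ p q, rlin p q v = ∑ i, ∑ j, rc p q i j * v i j := fun _ _ => rfl
  simp only [Rhat, Submodule.mem_inf, Submodule.mem_iInf, LinearMap.mem_ker, hL, hr]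
  constructor
  · rintro ⟨h, k⟩
    have h0 := h 0
    have h1 := h 1
    have h2 := h 2
    have h3 := h 3
    have h4 := h 4
    have k01 := k 0 1 (by decide)
    have k02 := k 0 2 (by decide)
    have k03 := k 0 3 (by decide)
    have k04 := k 0 4 (by decide)
    have k12 := k 1 2 (by decide)
    have k13 := k 1 3 (by decide)
    have k14 := k 1 4 (by decide)
    have k23 := k 2 3 (by decide)
    have k24 := k 2 4 (by decide)
    have k34 := k 3 4 (by decide)
    simp [rc, Fin.sum_univ_succ] at k01 k02 k03 k04 k12 k13 k14 k23 k24 k34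
    refine ⟨?_, ?_, ?_, ?_, ?_, ?_, ?_, ?_, ?_, ?_⟩ <;> linarith
  · rintro ⟨e1, e2, e3, e4, e5, e6, e7, e8, e9, e10⟩
    constructor
    · intro i
      fin_cases i <;> simp <;> linarith
    · intro p q hpq
      fin_cases p <;> fin_cases q <;> first
        | exact absurd hpq (by decide)
        | (simp [rc, Fin.sum_univ_succ]; linarith)

/-- The coordinates `(c₃, b₄, c₄, b₅, c₅)` on `R̂`. -/
def RhatCoord : Rhat →ₗ[ℝ] (Fin 5 → ℝ) where
  toFun v := ![v.1 2 2, v.1 3 1, v.1 3 2, v.1 4 1, v.1 4 2]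
  map_add' := by
    intro v w
    ext i
    fin_cases i <;> simp
  map_smul' := by
    intro c v
    ext i
    fin_cases i <;> simp

theorem RhatCoord_bijective : Function.Bijective RhatCoord := by
  constructor
  · rw [← LinearMap.ker_eq_bot, LinearMap.ker_eq_bot']
    rintro ⟨v, hv⟩ h
    have g0 : v 2 2 = 0 := congrFun h 0
    have g1 : v 3 1 = 0 := congrFun h 1
    have g2 : v 3 2 = 0 := congrFun h 2
    have g3 : v 4 1 = 0 := congrFun h 3
    have g4 : v 4 2 = 0 := congrFun h 4
    obtain ⟨e1, e2, e3, e4, e5, e6, e7, e8, e9, e10⟩ := (mem_Rhat_iff v).1 hv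
    ext i j
    fin_cases i <;> fin_cases j <;> simp <;> linarith
  · intro x
    refine ⟨⟨![![x 2 - x 4, - x 0 - x 3, x 0 - x 2 + x 3 + x 4],
      ![- x 1 + x 3, - x 0 + x 1 + x 2 - x 3, x 0 - x 2],
      ![- x 1 - x 2 + x 3 + x 4, - x 0 + x 1 + x 2 - x 3 - x 4, x 0],
      ![- x 1 - x 2, x 1, x 2], ![- x 3 - x 4, x 3, x 4]], ?_⟩, ?_⟩
    · rw [mem_Rhat_iff]
      simp
    · ext i
      fin_cases i <;> rfl

/-- The symmetry set `R̂ ⊆ L₅` is a 5-dimensional subspace of the 10-dimensional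
space `L₅`. -/
theorem Rhat_finrank : Rhat ≤ L5sub ∧ Module.finrank ℝ Rhat = 5 := by
  refine ⟨inf_le_left, ?_⟩
  rw [(LinearEquiv.ofBijective RhatCoord RhatCoord_bijective).finrank_eq]
  simp
end
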